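/- There exists a compact convex subset K of C([0,1], ℝ) whose closed linear span equals C([0,1], ℝ), such that there is no Lipschitz retraction from C([0,1], ℝ) onto K: no Lipschitz map R : C[0,1] → K satisfies R(k) = k for all k ∈ K. -/

import Mathlib

open Metric

open Filter Topology in
theorem exists_tendsto_ultrafilter_of_norm_le {ι X : Type*} [NormedAddCommGroup X] [ProperSpace X]
    (U : Ultrafilter ι) {u : ι → X} {M : ℝ} (hu : ∀ i, ‖u i‖ ≤ M) :
    ∃ x, ‖x‖ ≤ M ∧ Tendsto u U (𝓝 x) := by
  obtain ⟨x, hx, hlim⟩ := (isCompact_closedBall (0 : X) M).ultrafilter_le_nhds (U.map u)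
    (le_principal_iff.2 (Filter.mem_map.2 (Eventually.of_forall fun i ↦ by simpa using hu i)))
  exact ⟨x, by simpa using hx, hlim⟩

theorem exists_almost_invariant_average {G X : Type*} [AddCommGroup G] [NormedAddCommGroup X]
    [NormedSpace ℝ X] (N : ℕ) (S : Finset G) :
    ∃ A : (G → X) →ₗ[ℝ] X, (∀ x, A (fun _ ↦ x) = x) ∧
      (∀ f M, (∀ y, ‖f y‖ ≤ M) → ‖A f‖ ≤ M) ∧
      ∀ s ∈ S, ∀ f M, (∀ y, ‖f y‖ ≤ M) →
        ‖A (fun y ↦ f (s + y)) - A f‖ ≤ 2 * M / (N + 1) := by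
  classical
  have hN : (0 : ℝ) < N + 1 := by positivity
  induction S using Finset.induction_on with
  | empty => exact ⟨LinearMap.proj 0, by simp, fun f M h ↦ h 0, by simp⟩
  | insert s S _ ih =>
    obtain ⟨A, hconst, hbound, hinv⟩ := ih
    let B : (G → X) →ₗ[ℝ] (G → X) :=
      { toFun := fun f y ↦ (N + 1 : ℝ)⁻¹ • ∑ k ∈ Finset.range (N + 1), f (k • s + y)
        map_add' := fun f g ↦ by ext y; simp [Finset.sum_add_distrib]
        map_smul' := fun c f ↦ by
          ext y; simp only [Pi.smul_apply, RingHom.id_apply, ← Finset.smul_sum, smul_comm c] }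
    have hB (f : G → X) (M : ℝ) (hf : ∀ y, ‖f y‖ ≤ M) (y : G) : ‖B f y‖ ≤ M := by
      simp only [B, LinearMap.coe_mk, AddHom.coe_mk, norm_smul, norm_inv, Real.norm_eq_abs,
        abs_of_pos hN]
      rw [inv_mul_le_iff₀ hN]
      exact (norm_sum_le_of_le _ fun k _ ↦ hf _).trans (by simp)
    refine ⟨A ∘ₗ B, fun x ↦ ?_, fun f M hf ↦ hbound _ _ (hB f M hf), fun t ht f M hf ↦ ?_⟩
    · have : B (fun _ ↦ x) = fun _ ↦ x := by
        ext y
        simp only [B, LinearMap.coe_mk, AddHom.coe_mk, Finset.sum_const, Finset.card_range]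
        rw [← Nat.cast_smul_eq_nsmul ℝ, smul_smul]
        push_cast
        rw [inv_mul_cancel₀ hN.ne', one_smul]
      simp [this, hconst]
    · simp only [LinearMap.comp_apply]
      rcases Finset.mem_insert.1 ht with rfl | ht
      · rw [← map_sub]
        refine hbound _ _ fun y ↦ ?_
        have : (B (fun y ↦ f (t + y)) - B f) y =
            (N + 1 : ℝ)⁻¹ • (f ((N + 1) • t + y) - f y) := by
          simp only [B, LinearMap.coe_mk, AddHom.coe_mk, Pi.sub_apply, ← smul_sub,
            ← Finset.sum_sub_distrib]
          have := Finset.sum_range_sub (fun k ↦ f (k • t + y)) (N + 1)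
          simp only [zero_smul, zero_add] at this
          rw [← this]
          simp only [succ_nsmul', add_comm, add_left_comm]
        rw [this, norm_smul, norm_inv, Real.norm_eq_abs, abs_of_pos hN, inv_mul_eq_div]
        gcongr
        exact (norm_sub_le _ _).trans (by linarith [hf ((N + 1) • t + y), hf y])
      · have := hinv t ht (B f) M (hB f M hf)
        convert this using 4
        ext y
        simp [B, add_left_comm]

open Filter Topology in
theorem exists_invariant_mean (G X : Type*) [AddCommGroup G] [NormedAddCommGroup X]
    [NormedSpace ℝ X] [ProperSpace X] :
    ∃ m : (G → X) → X, (∀ x, m (fun _ ↦ x) = x) ∧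
      (∀ f M, (∀ y, ‖f y‖ ≤ M) → ‖m f‖ ≤ M) ∧
      (∀ f g M M', (∀ y, ‖f y‖ ≤ M) → (∀ y, ‖g y‖ ≤ M') →
        m (fun y ↦ f y - g y) = m f - m g) ∧
      ∀ f M, (∀ y, ‖f y‖ ≤ M) → ∀ s, m (fun y ↦ f (s + y)) = m f := by
  classical
  choose A hconst hbound hinv using
    fun i : ℕ × Finset G ↦ exists_almost_invariant_average (X := X) i.1 i.2
  let U : Ultrafilter (ℕ × Finset G) := .of atTop
  have hU : (U : Filter (ℕ × Finset G)) ≤ atTop := Ultrafilter.of_le _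
  have hlim (f : G → X) (hf : ∃ M, ∀ y, ‖f y‖ ≤ M) :
      Tendsto (fun i ↦ A i f) U (𝓝 (limUnder U fun i ↦ A i f)) := by
    obtain ⟨M, hM⟩ := hf
    obtain ⟨x, -, hx⟩ := exists_tendsto_ultrafilter_of_norm_le U fun i ↦ hbound i f M hM
    exact tendsto_nhds_limUnder ⟨x, hx⟩
  refine ⟨fun f ↦ limUnder U fun i ↦ A i f, fun x ↦ ?_, fun f M hf ↦ ?_,
    fun f g M M' hf hg ↦ ?_, fun f M hf s ↦ ?_⟩
  · simp only [hconst]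
    exact tendsto_const_nhds.limUnder_eq
  · exact le_of_tendsto (hlim f ⟨M, hf⟩).norm (.of_forall fun i ↦ hbound i f M hf)
  · refine Tendsto.limUnder_eq (((hlim f ⟨M, hf⟩).sub (hlim g ⟨M', hg⟩)).congr fun i ↦ ?_)
    exact (map_sub (A i) f g).symm
  · refine tendsto_nhds_unique (hlim _ ⟨M, fun y ↦ hf _⟩) ?_
    have h0 : Tendsto (fun i : ℕ × Finset G ↦ 2 * M / ((i.1 : ℝ) + 1)) U (𝓝 0) := by
      have : Tendsto (fun n : ℕ ↦ 2 * M / ((n : ℝ) + 1)) atTop (𝓝 0) :=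
        tendsto_const_nhds.div_atTop (tendsto_natCast_atTop_atTop.atTop_add tendsto_const_nhds)
      refine (this.comp ?_).mono_left hU
      rw [← prod_atTop_atTop_eq]
      exact tendsto_fst
    have h1 : Tendsto (fun i ↦ A i (fun y ↦ f (s + y)) - A i f) U (𝓝 0) := by
      refine squeeze_zero_norm' (hU ?_) h0
      filter_upwards [eventually_ge_atTop ((0, {s}) : ℕ × Finset G)] with i hi
      exact hinv i s (hi.2 (by simp)) f M hf
    simpa using h1.add (hlim f ⟨M, hf⟩)

theorem exists_linear_projection_of_lipschitz_retraction {E : Type*} [NormedAddCommGroup E]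
    [NormedSpace ℝ E] (X : Submodule ℝ E) [FiniteDimensional ℝ X] {L : ℝ} (F : E → X)
    (hF : ∀ x y, ‖F x - F y‖ ≤ L * ‖x - y‖) (hX : ∀ x : X, F x = x) :
    ∃ P : E →ₗ[ℝ] X, (∀ x, ‖P x‖ ≤ L * ‖x‖) ∧ ∀ x : X, P x = x := by
  have : ProperSpace X := FiniteDimensional.proper ℝ X
  obtain ⟨m, hconst, hbound, hsub, hinv⟩ := exists_invariant_mean X X
  obtain ⟨m', hconst', hbound', hsub', hinv'⟩ := exists_invariant_mean E X
  let F₁ (x : E) : X := m fun y ↦ F (y + x) - F y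
  have hF₁ (x y : E) : ‖F₁ x - F₁ y‖ ≤ L * ‖x - y‖ := by
    rw [← hsub _ _ (L * ‖x‖) (L * ‖y‖) (fun z ↦ by simpa using hF (z + x) z)
      (fun z ↦ by simpa using hF (z + y) z)]
    exact hbound _ _ fun z ↦ by simpa using hF (z + x) (z + y)
  have hF₁X (x : X) (y : E) : F₁ (x + y) - F₁ y = x := by
    have h1 : F₁ (x + y) = m (fun z ↦ F (((x + z : X) : E) + y) - F (x + z : X)) - m fun _ ↦ -x := by
      rw [← hsub _ _ (L * ‖y‖) ‖x‖ (fun z ↦ by simpa using hF (((x + z : X) : E) + y) (x + z : X))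
        (fun z ↦ by simp)]
      refine congrArg m (funext fun z ↦ ?_)
      rw [hX, hX, show (z : E) + (x + y) = ((x + z : X) : E) + y by push_cast; abel]
      abel
    rw [h1, hconst, hinv (fun z : X ↦ F ((z : E) + y) - F z) (L * ‖y‖)
      (fun z ↦ by simpa using hF ((z : E) + y) z)]
    simp [F₁]
  let P (x : E) : X := m' fun y ↦ F₁ (y + x) - F₁ y
  have hPb (x y : E) : ‖F₁ (y + x) - F₁ y‖ ≤ L * ‖x‖ := by simpa using hF₁ (y + x) y
  have hPadd (x y : E) : P (x + y) = P x + P y := by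
    rw [← sub_eq_iff_eq_add]
    have h1 : P x = m' fun z ↦ F₁ (y + z + x) - F₁ (y + z) :=
      (hinv' (fun z ↦ F₁ (z + x) - F₁ z) (L * ‖x‖) (hPb x) y).symm
    rw [h1, ← hsub' _ _ _ _ (hPb _) (fun z ↦ hPb y z)]
    refine congrArg m' (funext fun z ↦ ?_)
    rw [show z + (x + y) = y + z + x by abel, show z + y = y + z by abel]
    abel
  have hPnorm (x : E) : ‖P x‖ ≤ L * ‖x‖ := hbound' _ _ (hPb x)
  let P' : E →+ X := AddMonoidHom.mk' P hPadd
  have hPc : Continuous P' := AddMonoidHomClass.continuous_of_bound P' L hPnorm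
  refine ⟨(P'.toRealLinearMap hPc).toLinearMap, hPnorm, fun x ↦ ?_⟩
  change P x = x
  simp only [P, add_comm _ (x : E), hF₁X, hconst']

open Filter Topology in
theorem exists_no_approximate_retraction {E : Type*} [NormedAddCommGroup E]
    [NormedSpace ℝ E] (X : Submodule ℝ E) [FiniteDimensional ℝ X] {L : ℝ}
    (hL : ¬ ∃ P : E →ₗ[ℝ] X, (∀ x, ‖P x‖ ≤ L * ‖x‖) ∧ ∀ x : X, P x = x) :
    ∃ η > 0, ∀ F : E → X, (∀ x y, ‖F x - F y‖ ≤ L * ‖x - y‖ + η) →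
      ¬ ∀ x : X, ‖x‖ ≤ η⁻¹ → ‖F x - x‖ ≤ η := by
  have : ProperSpace X := FiniteDimensional.proper ℝ X
  by_contra! h
  choose F hF hFX using fun n : ℕ ↦ h (1 / ((n : ℝ) + 1)) (by positivity)
  let U : Ultrafilter ℕ := .of atTop
  have hU : (U : Filter ℕ) ≤ atTop := Ultrafilter.of_le _
  have hη : Tendsto (fun n : ℕ ↦ 1 / ((n : ℝ) + 1)) U (𝓝 0) :=
    tendsto_one_div_add_atTop_nhds_zero_nat.mono_left hU
  have hle (n : ℕ) : 1 / ((n : ℝ) + 1) ≤ 1 := by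
    rw [div_le_one (by positivity)]; linarith [n.cast_nonneg (α := ℝ)]
  have hF0 (n : ℕ) : ‖F n 0‖ ≤ 1 := by
    simpa using (hFX n 0 (by simp; positivity)).trans (hle n)
  have hlim (x : E) : ∃ z, Tendsto (fun n ↦ F n x) U (𝓝 z) := by
    obtain ⟨z, -, hz⟩ := exists_tendsto_ultrafilter_of_norm_le U (u := fun n ↦ F n x)
      (M := L * ‖x‖ + 1 + 1) fun n ↦ by
        have h1 := hF n x 0
        rw [sub_zero] at h1
        have h2 := norm_sub_norm_le (F n x) (F n 0)
        linarith [hle n, hF0 n]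
    exact ⟨z, hz⟩
  choose f hf using hlim
  refine hL (exists_linear_projection_of_lipschitz_retraction X f (fun x y ↦ ?_) fun x ↦ ?_)
  · have := tendsto_const_nhds (x := L * ‖x - y‖).add hη
    rw [add_zero] at this
    exact le_of_tendsto_of_tendsto' ((hf x).sub (hf y)).norm this fun n ↦ hF n x y
  · refine tendsto_nhds_unique (hf x) (tendsto_sub_nhds_zero_iff.1 (squeeze_zero_norm' (hU ?_) hη))
    filter_upwards [eventually_ge_atTop ⌈‖x‖⌉₊] with n hn
    refine hFX n x ?_
    rw [one_div, inv_inv]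
    linarith [Nat.ceil_le.1 hn]

theorem abs_sin_nat_mul_le (n : ℕ) (x : ℝ) : |Real.sin (n * x)| ≤ n * |Real.sin x| := by
  induction n with
  | zero => simp
  | succ n ih =>
    push_cast
    rw [add_mul, one_mul, Real.sin_add, add_mul, one_mul]
    refine (abs_add_le _ _).trans ?_
    rw [abs_mul, abs_mul]
    have h1 := mul_le_mul_of_nonneg_left (Real.abs_cos_le_one x) (abs_nonneg (Real.sin (n * x)))
    have h2 := mul_le_mul_of_nonneg_right (Real.abs_cos_le_one (n * x)) (abs_nonneg (Real.sin x))
    linarith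

theorem abs_sum_sub_div_le {σ : ℕ → ℝ} {B : ℝ} (hσ : ∀ k, |σ k| ≤ B) (m n : ℕ) :
    |∑ k ∈ Finset.Ico m n, (σ (k + 1) - σ k) / (k + 1)| ≤ 2 * B / (m + 1) := by
  have hB : 0 ≤ B := (abs_nonneg _).trans (hσ 0)
  rcases le_total n m with h | h
  · rw [Finset.Ico_eq_empty_of_le h]; simp; positivity
  have key : |∑ k ∈ Finset.Ico m n, (σ (k + 1) - σ k) / (k + 1) - σ n / (n + 1)| ≤
      2 * B / (m + 1) - B / (n + 1) := by
    induction n, h using Nat.le_induction with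
    | base =>
      simp only [Finset.Ico_self, Finset.sum_empty, zero_sub, abs_neg, abs_div]
      rw [abs_of_pos (by positivity : (0 : ℝ) < m + 1), ← sub_div]
      gcongr
      linarith [hσ m]
    | succ n h ih =>
      rw [Finset.sum_Ico_succ_top h]
      have hd : (0 : ℝ) ≤ 1 / (n + 1) - 1 / (n + 1 + 1) := by
        rw [sub_nonneg]; gcongr; linarith
      have h1 : |σ (n + 1) * (1 / (n + 1) - 1 / (n + 1 + 1))| ≤
          B * (1 / (n + 1) - 1 / (n + 1 + 1)) := by
        rw [abs_mul, abs_of_nonneg hd]; gcongr; exact hσ _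
      have h2 := abs_add_le _ _ |>.trans (add_le_add ih h1)
      push_cast
      refine (le_of_eq ?_).trans (h2.trans (le_of_eq ?_))
      · exact congrArg abs (by ring)
      · ring
  have h1 : |σ n / (n + 1)| ≤ B / (n + 1) := by
    rw [abs_div, abs_of_pos (by positivity : (0 : ℝ) < n + 1)]; gcongr; exact hσ n
  have h2 := (abs_add_le _ _).trans (add_le_add key h1)
  simpa using h2

theorem abs_sum_sin_div_le (n : ℕ) (θ : ℝ) :
    |∑ k ∈ Finset.range n, Real.sin ((k + 1) * θ) / (k + 1)| ≤ 3 := by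
  set s := |Real.sin (θ / 2)| with hs
  have hs0 : 0 ≤ s := abs_nonneg _
  have hterm (k : ℕ) : |Real.sin ((k + 1) * θ) / (k + 1)| ≤ 2 * s := by
    have h1 := abs_sin_nat_mul_le (2 * (k + 1)) (θ / 2)
    push_cast at h1
    rw [abs_div, abs_of_pos (by positivity : (0 : ℝ) < k + 1), div_le_iff₀ (by positivity)]
    refine (le_of_eq ?_).trans (h1.trans (le_of_eq ?_))
    · exact congrArg (fun x ↦ |Real.sin x|) (by ring)
    · rw [hs]; ring
  rcases hs0.eq_or_lt with h0 | h0
  · refine (Finset.abs_sum_le_sum_abs _ _).trans ((Finset.sum_le_sum fun k _ ↦ hterm k).trans ?_)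
    simp [← h0]
  have hhead (j : ℕ) (hj : j * s ≤ 1) :
      |∑ k ∈ Finset.range j, Real.sin ((k + 1) * θ) / (k + 1)| ≤ 2 := by
    refine (Finset.abs_sum_le_sum_abs _ _).trans ((Finset.sum_le_sum fun k _ ↦ hterm k).trans ?_)
    simp only [Finset.sum_const, Finset.card_range, nsmul_eq_mul]
    linarith
  set m := ⌊1 / s⌋₊
  have hm : m * s ≤ 1 := by
    rw [← le_div_iff₀ h0]; exact Nat.floor_le (by positivity)
  have hm' : 1 < (m + 1) * s := by
    rw [← div_lt_iff₀ h0]; exact Nat.lt_floor_add_one _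
  rcases le_total n m with h | h
  · have : n * s ≤ 1 := le_trans (by gcongr) hm
    linarith [hhead n this]
  rw [← Finset.sum_range_add_sum_Ico _ h]
  let σ (k : ℕ) : ℝ := -Real.cos ((k + 1 / 2) * θ) / (2 * Real.sin (θ / 2))
  have hσ (k : ℕ) : |σ k| ≤ 1 / (2 * s) := by
    simp only [σ, abs_div, abs_neg, abs_mul, abs_two]
    gcongr
    exact Real.abs_cos_le_one _
  have hsin (k : ℕ) : Real.sin ((k + 1) * θ) = σ (k + 1) - σ k := by
    have hne : Real.sin (θ / 2) ≠ 0 := abs_pos.1 h0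
    simp only [σ, ← sub_div]
    rw [eq_div_iff (by simpa using hne)]
    push_cast
    rw [show ((k : ℝ) + 1 + 1 / 2) * θ = (k + 1) * θ + θ / 2 by ring,
      show ((k : ℝ) + 1 / 2) * θ = (k + 1) * θ - θ / 2 by ring, Real.cos_add, Real.cos_sub]
    ring
  have htail := abs_sum_sub_div_le hσ m n
  simp only [← hsin] at htail
  have h1 : 2 * (1 / (2 * s)) / ((m : ℝ) + 1) ≤ 1 := by
    rw [div_le_one (by positivity), show 2 * (1 / (2 * s)) = 1 / s by field_simp,
      div_le_iff₀ h0]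
    exact hm'.le
  linarith [abs_add_le (∑ k ∈ Finset.range m, Real.sin ((k + 1) * θ) / (k + 1))
    (∑ k ∈ Finset.Ico m n, Real.sin ((k + 1) * θ) / (k + 1)), hhead m hm]

theorem integral_cos_natCast_mul (k : ℕ) :
    ∫ t in (0 : ℝ)..Real.pi, Real.cos (k * t) = if k = 0 then Real.pi else 0 := by
  split_ifs with h
  · simp [h]
  · rw [intervalIntegral.integral_comp_mul_left (fun x ↦ Real.cos x) (by exact_mod_cast h)]
    simp [integral_cos, Real.sin_nat_mul_pi]

theorem integral_cos_mul_cos_natCast (j k : ℕ) :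
    ∫ t in (0 : ℝ)..Real.pi, Real.cos (j * t) * Real.cos (k * t) =
      if j = k then (if k = 0 then Real.pi else Real.pi / 2) else 0 := by
  wlog h : k ≤ j generalizing j k
  · have := this k j (le_of_not_ge h)
    simp only [mul_comm (Real.cos (k * _))] at this
    rw [this]
    aesop
  have (t : ℝ) : Real.cos (j * t) * Real.cos (k * t) =
      (1 / 2) * (Real.cos ((j + k : ℕ) * t) + Real.cos ((j - k : ℕ) * t)) := by
    push_cast [h]
    rw [add_mul, sub_mul, Real.cos_add, Real.cos_sub]; ring
  simp only [this]
  rw [intervalIntegral.integral_const_mul, intervalIntegral.integral_add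
    (Continuous.intervalIntegrable (by fun_prop) _ _)
    (Continuous.intervalIntegrable (by fun_prop) _ _), integral_cos_natCast_mul,
    integral_cos_natCast_mul]
  rcases eq_or_ne j k with rfl | hjk
  · rcases eq_or_ne j 0 with rfl | hj
    · simp; ring
    · simp [hj]; ring
  · have h1 : j + k ≠ 0 := by omega
    have h2 : j - k ≠ 0 := by omega
    simp [h2, hjk]
    omega

/-- The point `(1 + cos t) / 2` of the unit interval. -/
noncomputable def cosPoint (t : ℝ) : Set.Icc (0 : ℝ) 1 :=
  ⟨(1 + Real.cos t) / 2, by linarith [Real.neg_one_le_cos t], by linarith [Real.cos_le_one t]⟩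

theorem continuous_cosPoint : Continuous cosPoint := by
  unfold cosPoint
  fun_prop

theorem exists_cosPoint_eq (x : Set.Icc (0 : ℝ) 1) : ∃ t, cosPoint t = x := by
  refine ⟨Real.arccos (2 * x - 1), Subtype.ext ?_⟩
  obtain ⟨x, h0, h1⟩ := x
  simp only [cosPoint]
  rw [Real.cos_arccos (by linarith) (by linarith)]
  ring

/-- The `k`-th Chebyshev polynomial shifted to the unit interval. -/
noncomputable def shiftedChebyshev (k : ℕ) : C(Set.Icc (0 : ℝ) 1, ℝ) :=
  Polynomial.toContinuousMapOnAlgHom (Set.Icc (0 : ℝ) 1)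
    ((Polynomial.Chebyshev.T ℝ k).comp (2 * Polynomial.X - 1))

theorem shiftedChebyshev_cosPoint (k : ℕ) (t : ℝ) :
    shiftedChebyshev k (cosPoint t) = Real.cos (k * t) := by
  simp only [shiftedChebyshev, cosPoint, Polynomial.toContinuousMapOnAlgHom_apply,
    Polynomial.toContinuousMapOn_apply, Polynomial.toContinuousMap_apply, Polynomial.eval_comp]
  rw [show Polynomial.eval ((1 + Real.cos t) / 2) (2 * Polynomial.X - 1) = Real.cos t by
    simp; ring]
  exact_mod_cast Polynomial.Chebyshev.T_real_cos t k

/-- The polynomial functions of degree at most `n` on the unit interval. -/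
noncomputable def chebyshevSpan (n : ℕ) : Submodule ℝ C(Set.Icc (0 : ℝ) 1, ℝ) :=
  Submodule.span ℝ (shiftedChebyshev '' Set.Iic n)

instance finiteDimensional_chebyshevSpan (n : ℕ) : FiniteDimensional ℝ (chebyshevSpan n) :=
  FiniteDimensional.span_of_finite ℝ ((Set.finite_Iic n).image _)

theorem chebyshevSpan_mono : Monotone chebyshevSpan := fun _ _ h ↦
  Submodule.span_mono (Set.image_mono (Set.Iic_subset_Iic.2 h))

theorem shiftedChebyshev_mem {k n : ℕ} (h : k ≤ n) : shiftedChebyshev k ∈ chebyshevSpan n :=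
  Submodule.subset_span ⟨k, h, rfl⟩

theorem topologicalClosure_span_shiftedChebyshev :
    (Submodule.span ℝ (Set.range shiftedChebyshev)).topologicalClosure = ⊤ := by
  have hT : Submodule.span ℝ (Set.range fun k : ℕ ↦ Polynomial.Chebyshev.T ℝ k) = ⊤ :=
    (Polynomial.Chebyshev.chebyshevTsequence (R := ℝ)).span fun i ↦
      isUnit_iff_ne_zero.2 <| Polynomial.leadingCoeff_ne_zero.2 <|
        (Polynomial.Chebyshev.chebyshevTsequence (R := ℝ)).ne_zero i
  have hle : (polynomialFunctions (Set.Icc (0 : ℝ) 1)).toSubmodule ≤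
      Submodule.span ℝ (Set.range shiftedChebyshev) := by
    rintro _ ⟨p, -, rfl⟩
    let Φ : Polynomial ℝ →ₗ[ℝ] C(Set.Icc (0 : ℝ) 1, ℝ) :=
      ((Polynomial.toContinuousMapOnAlgHom (Set.Icc (0 : ℝ) 1)).comp
        (Polynomial.aeval (2 * Polynomial.X - 1))).toLinearMap
    have hΦ (q : Polynomial ℝ) : Φ q ∈ Submodule.span ℝ (Set.range shiftedChebyshev) := by
      have hq : q ∈ Submodule.span ℝ (Set.range fun k : ℕ ↦ Polynomial.Chebyshev.T ℝ k) := by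
        simp [hT]
      have := Submodule.mem_map_of_mem (f := Φ) hq
      rw [Submodule.map_span, ← Set.range_comp] at this
      have hΦT : ⇑Φ ∘ (fun k : ℕ ↦ Polynomial.Chebyshev.T ℝ k) = shiftedChebyshev := by
        ext1 k
        simp [Φ, shiftedChebyshev, Polynomial.comp_eq_aeval]
      rwa [hΦT] at this
    convert hΦ (p.comp (Polynomial.C (1 / 2) * (Polynomial.X + 1))) using 1
    ext x
    simp [Φ, ← Polynomial.comp_eq_aeval]
  rw [eq_top_iff]
  refine le_trans ?_ (Submodule.topologicalClosure_mono hle)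
  intro f _
  exact continuousMap_mem_polynomialFunctions_closure 0 1 f

theorem integral_cos_mul_eq_zero {n b : ℕ} (hb : n < b) {h : C(Set.Icc (0 : ℝ) 1, ℝ)}
    (hh : h ∈ chebyshevSpan n) :
    ∫ t in (0 : ℝ)..Real.pi, Real.cos (b * t) * h (cosPoint t) = 0 := by
  have hint (h : C(Set.Icc (0 : ℝ) 1, ℝ)) : IntervalIntegrable
      (fun t ↦ Real.cos (b * t) * h (cosPoint t)) MeasureTheory.volume 0 Real.pi :=
    Continuous.intervalIntegrable
      ((by fun_prop : Continuous fun t : ℝ ↦ Real.cos (b * t)).mul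
        (h.continuous.comp continuous_cosPoint)) _ _
  induction hh using Submodule.span_induction with
  | mem x hx =>
    obtain ⟨k, hk, rfl⟩ := hx
    simp only [shiftedChebyshev_cosPoint]
    rw [integral_cos_mul_cos_natCast, if_neg (by simp only [Set.mem_Iic] at hk; omega)]
  | zero => simp
  | add x y _ _ hx hy =>
    simp only [ContinuousMap.add_apply, mul_add]
    rw [intervalIntegral.integral_add (hint x) (hint y), hx, hy, add_zero]
  | smul c x _ hx =>
    simp only [ContinuousMap.smul_apply, smul_eq_mul, mul_left_comm _ c]
    rw [intervalIntegral.integral_const_mul, hx, mul_zero]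

/-- Symmetrized translates of the Fejér polynomial `2 sin (n θ) ∑ sin (k θ) / k`. -/
noncomputable def fejerTranslate (n : ℕ) (t : ℝ) : C(Set.Icc (0 : ℝ) 1, ℝ) :=
  ∑ k ∈ Finset.range n, (1 / (k + 1 : ℝ)) •
    (Real.cos ((n - (k + 1) : ℕ) * t) • shiftedChebyshev (n - (k + 1)) -
      Real.cos ((n + (k + 1) : ℕ) * t) • shiftedChebyshev (n + (k + 1)))

theorem abs_sum_cos_sub_cos_div_le (n : ℕ) (u : ℝ) :
    |∑ k ∈ Finset.range n, (1 / (k + 1 : ℝ)) *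
      (Real.cos ((n - (k + 1) : ℕ) * u) - Real.cos ((n + (k + 1) : ℕ) * u))| ≤ 6 := by
  have h1 : ∑ k ∈ Finset.range n, (1 / (k + 1 : ℝ)) *
      (Real.cos ((n - (k + 1) : ℕ) * u) - Real.cos ((n + (k + 1) : ℕ) * u)) =
      2 * Real.sin (n * u) * ∑ k ∈ Finset.range n, Real.sin ((k + 1) * u) / (k + 1) := by
    rw [Finset.mul_sum]
    refine Finset.sum_congr rfl fun k hk ↦ ?_
    rw [Nat.cast_sub (Finset.mem_range.1 hk)]
    push_cast
    rw [sub_mul, add_mul (n : ℝ), Real.cos_sub, Real.cos_add]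
    ring
  rw [h1, abs_mul, abs_mul, abs_two]
  nlinarith [abs_sum_sin_div_le n u, Real.abs_sin_le_one (n * u), abs_nonneg (Real.sin (n * u))]

theorem norm_fejerTranslate_le (n : ℕ) (t : ℝ) : ‖fejerTranslate n t‖ ≤ 6 := by
  rw [ContinuousMap.norm_le _ (by norm_num)]
  intro x
  obtain ⟨θ, rfl⟩ := exists_cosPoint_eq x
  have h1 : fejerTranslate n t (cosPoint θ) = (1 / 2) *
      ((∑ k ∈ Finset.range n, (1 / (k + 1 : ℝ)) * (Real.cos ((n - (k + 1) : ℕ) * (t + θ)) -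
          Real.cos ((n + (k + 1) : ℕ) * (t + θ)))) +
        ∑ k ∈ Finset.range n, (1 / (k + 1 : ℝ)) * (Real.cos ((n - (k + 1) : ℕ) * (t - θ)) -
          Real.cos ((n + (k + 1) : ℕ) * (t - θ)))) := by
    rw [← Finset.sum_add_distrib, Finset.mul_sum, fejerTranslate, ContinuousMap.sum_apply]
    refine Finset.sum_congr rfl fun k _ ↦ ?_
    simp only [ContinuousMap.smul_apply, ContinuousMap.sub_apply, smul_eq_mul,
      shiftedChebyshev_cosPoint, mul_add _ t θ, mul_sub _ t θ, Real.cos_add, Real.cos_sub]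
    ring
  have h2 := abs_sum_cos_sub_cos_div_le n (t + θ)
  have h3 := abs_sum_cos_sub_cos_div_le n (t - θ)
  rw [Real.norm_eq_abs, h1, abs_mul, abs_of_pos (by norm_num : (0 : ℝ) < 1 / 2)]
  refine (mul_le_mul_of_nonneg_left (abs_add_le _ _) (by norm_num)).trans ?_
  linarith

theorem harmonic_le_of_projection_chebyshevSpan {n : ℕ} {L : ℝ}
    (P : C(Set.Icc (0 : ℝ) 1, ℝ) →ₗ[ℝ] chebyshevSpan n) (hL : ∀ f, ‖P f‖ ≤ L * ‖f‖)
    (hP : ∀ f : chebyshevSpan n, P f = f) :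
    ∑ k ∈ Finset.range n, 1 / ((k : ℝ) + 1) ≤ 12 * L := by
  have hL0 : 0 ≤ L := by
    have := (norm_nonneg _).trans (hL 1)
    rwa [norm_one, mul_one] at this
  have hcont (h : C(Set.Icc (0 : ℝ) 1, ℝ)) (j : ℕ) :
      Continuous fun t : ℝ ↦ Real.cos (j * t) * h (cosPoint t) :=
    (by fun_prop : Continuous fun t : ℝ ↦ Real.cos (j * t)).mul
      (h.continuous.comp continuous_cosPoint)
  have hPf (t : ℝ) : (P (fejerTranslate n t) : C(Set.Icc (0 : ℝ) 1, ℝ)) (cosPoint t) =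
      ∑ k ∈ Finset.range n, (1 / (k + 1 : ℝ)) *
        (Real.cos ((n - (k + 1) : ℕ) * t) * shiftedChebyshev (n - (k + 1)) (cosPoint t) -
          Real.cos ((n + (k + 1) : ℕ) * t) *
            (P (shiftedChebyshev (n + (k + 1))) : C(Set.Icc (0 : ℝ) 1, ℝ)) (cosPoint t)) := by
    have hlow (k : ℕ) : P (shiftedChebyshev (n - (k + 1))) =
        ⟨shiftedChebyshev (n - (k + 1)), shiftedChebyshev_mem (Nat.sub_le _ _)⟩ :=
      hP ⟨_, shiftedChebyshev_mem (Nat.sub_le _ _)⟩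
    simp [fejerTranslate, hlow, ContinuousMap.sum_apply]
  have hint : ∫ t in (0 : ℝ)..Real.pi,
      (P (fejerTranslate n t) : C(Set.Icc (0 : ℝ) 1, ℝ)) (cosPoint t) =
      ∑ k ∈ Finset.range n, (1 / (k + 1 : ℝ)) *
        (if n - (k + 1) = 0 then Real.pi else Real.pi / 2) := by
    simp only [hPf]
    rw [intervalIntegral.integral_finsetSum fun k _ ↦ Continuous.intervalIntegrable
      (continuous_const.fun_mul ((hcont _ _).fun_sub (hcont _ _))) _ _]
    refine Finset.sum_congr rfl fun k _ ↦ ?_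
    rw [intervalIntegral.integral_const_mul, intervalIntegral.integral_sub
      ((hcont _ _).intervalIntegrable _ _) ((hcont _ _).intervalIntegrable _ _),
      integral_cos_mul_eq_zero (by omega) (P _).2]
    simp only [shiftedChebyshev_cosPoint]
    rw [integral_cos_mul_cos_natCast, if_pos rfl, sub_zero]
  have hupper := intervalIntegral.norm_integral_le_of_norm_le_const (a := 0) (b := Real.pi)
    (C := L * 6) (f := fun t ↦ (P (fejerTranslate n t) : C(Set.Icc (0 : ℝ) 1, ℝ)) (cosPoint t))
    fun t _ ↦ (ContinuousMap.norm_coe_le_norm _ _).trans ((hL _).trans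
      (mul_le_mul_of_nonneg_left (norm_fejerTranslate_le n t) hL0))
  have hlower : Real.pi / 2 * ∑ k ∈ Finset.range n, 1 / ((k : ℝ) + 1) ≤
      ∑ k ∈ Finset.range n, (1 / (k + 1 : ℝ)) *
        (if n - (k + 1) = 0 then Real.pi else Real.pi / 2) := by
    rw [Finset.mul_sum]
    refine Finset.sum_le_sum fun k _ ↦ ?_
    rw [mul_comm]
    gcongr
    split_ifs <;> linarith [Real.pi_pos]
  rw [hint, sub_zero, abs_of_pos Real.pi_pos, Real.norm_eq_abs] at hupper
  have := hlower.trans ((le_abs_self _).trans hupper)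
  nlinarith [Real.pi_pos]

theorem not_exists_projection_chebyshevSpan {n : ℕ} (hn : 0 < n) :
    ¬ ∃ P : C(Set.Icc (0 : ℝ) 1, ℝ) →ₗ[ℝ] chebyshevSpan n,
      (∀ f, ‖P f‖ ≤ (∑ k ∈ Finset.range n, 1 / ((k : ℝ) + 1)) / 13 * ‖f‖) ∧
        ∀ f : chebyshevSpan n, P f = f := by
  rintro ⟨P, hL, hP⟩
  have h := harmonic_le_of_projection_chebyshevSpan P hL hP
  have hpos : 0 < ∑ k ∈ Finset.range n, 1 / ((k : ℝ) + 1) :=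
    Finset.sum_pos (fun k _ ↦ by positivity) (Finset.nonempty_range_iff.2 hn.ne')
  linarith

open Filter Topology in
theorem exists_rapidly_decreasing_seq {η : ℕ → ℝ} (hη : ∀ n, 0 < η n) :
    ∃ δ : ℕ → ℝ, (∀ n, 0 < δ n) ∧ Antitone δ ∧ Tendsto δ atTop (𝓝 0) ∧
      ∀ n, δ (n + 1) ≤ δ n * η n := by
  let r (n : ℕ) : ℝ := min (η n) (1 / 2)
  have hr (n : ℕ) : 0 < r n := lt_min (hη n) (by norm_num)
  let δ (n : ℕ) : ℝ := ∏ k ∈ Finset.range n, r k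
  have hδ (n : ℕ) : 0 < δ n := Finset.prod_pos fun k _ ↦ hr k
  have hsucc (n : ℕ) : δ (n + 1) = δ n * r n := Finset.prod_range_succ _ _
  have hpow (n : ℕ) : δ n ≤ (1 / 2) ^ n := by
    refine (Finset.prod_le_prod (fun k _ ↦ (hr k).le) fun k _ ↦ min_le_right _ _).trans ?_
    simp
  refine ⟨δ, hδ, antitone_nat_of_succ_le fun n ↦ ?_, squeeze_zero (fun n ↦ (hδ n).le) hpow
    (tendsto_pow_atTop_nhds_zero_of_lt_one (by norm_num) (by norm_num)), fun n ↦ ?_⟩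
  · rw [hsucc]
    exact mul_le_of_le_one_right (hδ n).le ((min_le_right _ _).trans (by norm_num))
  · rw [hsucc]
    exact mul_le_mul_of_nonneg_left (min_le_left _ _) (hδ n).le

section ThickenedSubspaces

variable {E : Type*} [NormedAddCommGroup E] [NormedSpace ℝ E]

/-- The vectors of norm at most `δ 0` lying within `δ (n + 1)` of `X n` for every `n`. -/
def thickenedSubspaces (X : ℕ → Submodule ℝ E) (δ : ℕ → ℝ) : Set E :=
  closedBall 0 (δ 0) ∩ ⋂ n, cthickening (δ (n + 1)) (X n : Set E)

theorem convex_thickenedSubspaces (X : ℕ → Submodule ℝ E) (δ : ℕ → ℝ) :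
    Convex ℝ (thickenedSubspaces X δ) :=
  (convex_closedBall 0 _).inter (convex_iInter fun n ↦ (X n).convex.cthickening _)

theorem exists_norm_sub_lt_of_mem_thickenedSubspaces {X : ℕ → Submodule ℝ E} {δ : ℕ → ℝ} {f : E}
    (hf : f ∈ thickenedSubspaces X δ) (n : ℕ) {r : ℝ} (hr : 0 < r) (h : δ (n + 1) < r) :
    ∃ g : X n, ‖f - g‖ < r := by
  obtain ⟨g, hg, hfg⟩ := mem_thickening_iff.1
    (cthickening_subset_thickening' hr h _ (Set.mem_iInter.1 hf.2 n))
  exact ⟨⟨g, hg⟩, by rwa [← dist_eq_norm]⟩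

open Filter Topology in
theorem isCompact_thickenedSubspaces [CompleteSpace E] (X : ℕ → Submodule ℝ E)
    [∀ n, FiniteDimensional ℝ (X n)] {δ : ℕ → ℝ} (hδ : Tendsto δ atTop (𝓝 0)) :
    IsCompact (thickenedSubspaces X δ) := by
  refine TotallyBounded.isCompact_of_isClosed (Metric.totallyBounded_iff.2 fun ε hε ↦ ?_)
    (isClosed_closedBall.inter (isClosed_iInter fun n ↦ isClosed_cthickening))
  obtain ⟨n, hn⟩ := ((hδ.comp (tendsto_add_atTop_nat 1)).eventually
    (gt_mem_nhds (half_pos hε))).exists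
  have : ProperSpace (X n) := FiniteDimensional.proper ℝ (X n)
  have hC : IsCompact ((↑) '' closedBall (0 : X n) (δ 0 + ε / 2) : Set E) :=
    (isCompact_closedBall _ _).image continuous_subtype_val
  obtain ⟨t, ht, hcover⟩ := Metric.totallyBounded_iff.1 hC.totallyBounded (ε / 2) (half_pos hε)
  refine ⟨t, ht, fun f hf ↦ ?_⟩
  obtain ⟨g, hg⟩ := exists_norm_sub_lt_of_mem_thickenedSubspaces hf n (half_pos hε) hn
  have hgn : g ∈ closedBall (0 : X n) (δ 0 + ε / 2) := by
    have h1 : ‖f‖ ≤ δ 0 := by simpa using hf.1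
    have h2 := norm_sub_norm_le (g : E) f
    rw [norm_sub_rev] at h2
    rw [mem_closedBall_zero_iff, Submodule.coe_norm]
    linarith
  obtain ⟨z, hz, hgz⟩ := Set.mem_iUnion₂.1 (hcover ⟨g, hgn, rfl⟩)
  refine Set.mem_iUnion₂.2 ⟨z, hz, ?_⟩
  rw [mem_ball] at hgz ⊢
  have := dist_triangle f g z
  rw [dist_eq_norm f (g : E)] at this
  linarith

theorem mem_thickenedSubspaces {X : ℕ → Submodule ℝ E} (hX : Monotone X) {δ : ℕ → ℝ}
    (hδ : Antitone δ) {n : ℕ} {f : E} (hf : f ∈ X n) (hfn : ‖f‖ ≤ δ n) :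
    f ∈ thickenedSubspaces X δ := by
  refine ⟨by simpa using hfn.trans (hδ n.zero_le), Set.mem_iInter.2 fun j ↦ ?_⟩
  rcases lt_or_ge j n with h | h
  · exact mem_cthickening_of_dist_le f 0 _ _ (X j).zero_mem
      (by simpa using hfn.trans (hδ h))
  · exact self_subset_cthickening _ (hX h hf)

theorem topologicalClosure_span_thickenedSubspaces {X : ℕ → Submodule ℝ E} (hX : Monotone X)
    {δ : ℕ → ℝ} (hδ : Antitone δ) (hpos : ∀ n, 0 < δ n)
    (hdense : (⨆ n, X n).topologicalClosure = ⊤) :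
    (Submodule.span ℝ (thickenedSubspaces X δ)).topologicalClosure = ⊤ := by
  refine eq_top_iff.2 (hdense.ge.trans (Submodule.topologicalClosure_mono (iSup_le fun n f hf ↦ ?_)))
  have hc : 0 < δ n / (‖f‖ + 1) := div_pos (hpos n) (by positivity)
  rw [← Submodule.smul_mem_iff _ hc.ne']
  refine Submodule.subset_span (mem_thickenedSubspaces hX hδ ((X n).smul_mem _ hf) ?_)
  rw [norm_smul, Real.norm_of_nonneg hc.le, div_mul_eq_mul_div, div_le_iff₀ (by positivity)]
  exact mul_le_mul_of_nonneg_left (by linarith) (hpos n).le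

theorem no_lipschitz_retraction_onto_thickenedSubspaces {X : ℕ → Submodule ℝ E}
    (hX : Monotone X) {δ : ℕ → ℝ} (hδ : Antitone δ) (hpos : ∀ n, 0 < δ n) {n : ℕ} {η L : ℝ}
    (hη : 0 < η) (hδη : δ (n + 1) ≤ δ n * (η ^ 2 / 4))
    (hF : ∀ F : E → X n, (∀ x y, ‖F x - F y‖ ≤ L * ‖x - y‖ + η) →
      ¬ ∀ x : X n, ‖x‖ ≤ η⁻¹ → ‖F x - x‖ ≤ η)
    {R : E → E} (hR : ∀ x y, ‖R x - R y‖ ≤ L * ‖x - y‖)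
    (hRmem : ∀ x, R x ∈ thickenedSubspaces X δ) :
    ¬ ∀ x ∈ thickenedSubspaces X δ, R x = x := by
  intro hRid
  set s := δ n * η with hs
  have hs0 : 0 < s := mul_pos (hpos n) hη
  have hr : δ (n + 1) < s * η / 2 := by
    have := mul_pos hs0 hη
    rw [hs] at this ⊢
    linarith
  have hr0 : 0 < s * η / 2 := by positivity
  choose g hg using fun x ↦ exists_norm_sub_lt_of_mem_thickenedSubspaces (hRmem x) n hr0 hr
  refine hF (fun x ↦ s⁻¹ • g (s • x)) (fun x y ↦ ?_) fun x hx ↦ ?_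
  · rw [← smul_sub, norm_smul, norm_inv, Real.norm_of_nonneg hs0.le, inv_mul_le_iff₀ hs0,
      Submodule.coe_norm, Submodule.coe_sub]
    have h1 := hR (s • x) (s • y)
    rw [← smul_sub, norm_smul, Real.norm_of_nonneg hs0.le] at h1
    have h2 := hg (s • x)
    rw [norm_sub_rev] at h2
    have h3 := hg (s • y)
    have h4 := norm_add₃_le (a := g (s • x) - R (s • x)) (b := R (s • x) - R (s • y))
      (c := R (s • y) - g (s • y))
    rw [show (g (s • x) : E) - R (s • x) + (R (s • x) - R (s • y)) + (R (s • y) - g (s • y)) =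
      g (s • x) - g (s • y) by abel] at h4
    linarith
  · have hxs : R (s • (x : E)) = s • (x : E) := by
      refine hRid _ (mem_thickenedSubspaces hX hδ ((X n).smul_mem s x.2) ?_)
      rw [norm_smul, Real.norm_of_nonneg hs0.le, hs, mul_assoc]
      refine mul_le_of_le_one_right (hpos n).le ?_
      rw [← le_inv_mul_iff₀ hη, mul_one]
      exact hx
    have h1 := hg (s • (x : E))
    rw [hxs, norm_sub_rev] at h1
    have h2 : s⁻¹ • g (s • (x : E)) - x = s⁻¹ • (g (s • (x : E)) - s • x) := by
      rw [smul_sub, inv_smul_smul₀ hs0.ne']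
    rw [h2, norm_smul, norm_inv, Real.norm_of_nonneg hs0.le, inv_mul_le_iff₀ hs0,
      Submodule.coe_norm]
    push_cast
    linarith

end ThickenedSubspaces

open Filter in
/-- There exists a compact convex subset `K` of `C([0,1], ℝ)` whose closed
linear span is all of `C([0,1], ℝ)` such that there is no Lipschitz retraction from
`C([0,1], ℝ)` onto `K`. -/
theorem exists_generating_convex_compact_without_lipschitz_retraction :
    ∃ K : Set C(Set.Icc (0 : ℝ) 1, ℝ),
      IsCompact K ∧ Convex ℝ K ∧
      (Submodule.span ℝ K).topologicalClosure = ⊤ ∧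
      ¬ ∃ (L : NNReal) (R : C(Set.Icc (0 : ℝ) 1, ℝ) → C(Set.Icc (0 : ℝ) 1, ℝ)),
          LipschitzWith L R ∧ (∀ f, R f ∈ K) ∧ ∀ k ∈ K, R k = k := by
  choose η hη hF using fun n : ℕ ↦ exists_no_approximate_retraction (chebyshevSpan (n + 1))
    (not_exists_projection_chebyshevSpan n.succ_pos)
  obtain ⟨δ, hpos, hanti, hlim, hδη⟩ := exists_rapidly_decreasing_seq
    (η := fun n ↦ η n ^ 2 / 4) fun n ↦ by have := hη n; positivity
  have hmono : Monotone fun n ↦ chebyshevSpan (n + 1) := fun m n h ↦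
    chebyshevSpan_mono (Nat.succ_le_succ h)
  refine ⟨thickenedSubspaces (fun n ↦ chebyshevSpan (n + 1)) δ,
    isCompact_thickenedSubspaces _ hlim, convex_thickenedSubspaces _ _,
    topologicalClosure_span_thickenedSubspaces hmono hanti hpos ?_, ?_⟩
  · refine eq_top_iff.2 (topologicalClosure_span_shiftedChebyshev.ge.trans
      (Submodule.topologicalClosure_mono (Submodule.span_le.2 ?_)))
    rintro _ ⟨k, rfl⟩
    exact Submodule.mem_iSup_of_mem k (shiftedChebyshev_mem k.le_succ)
  · rintro ⟨L, R, hR, hRmem, hRid⟩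
    obtain ⟨n, hn⟩ := ((Real.tendsto_sum_range_one_div_nat_succ_atTop.comp
      (tendsto_add_atTop_nat 1)).eventually_ge_atTop (13 * (L : ℝ))).exists
    refine no_lipschitz_retraction_onto_thickenedSubspaces hmono hanti hpos (hη n) (hδη n) (hF n)
      (fun x y ↦ ?_) hRmem hRid
    have hL : (L : ℝ) ≤ (∑ k ∈ Finset.range (n + 1), 1 / ((k : ℝ) + 1)) / 13 := by
      rw [le_div_iff₀ (by norm_num), mul_comm]
      exact hn
    have := hR.dist_le_mul x y
    rw [dist_eq_norm, dist_eq_norm] at this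
    exact this.trans (mul_le_mul_of_nonneg_right hL (norm_nonneg _))
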